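/- Let Y be a measurable subset of the plane of area |Y| and let r > 0. Then the area of the set Z = {p ∉ Y : dist(p, Y) ≤ r} of points within distance r of Y but not in Y is at least πr² + 2r√(π|Y|). -/

import Mathlib

open MeasureTheory Metric Real

/-- One-dimensional Brunn–Minkowski inequality for compact sets. -/
theorem volume_add_volume_le_of_isCompact {A B C : Set ℝ} (hA : IsCompact A) (hB : IsCompact B)
    (hA' : A.Nonempty) (hB' : B.Nonempty) (h : ∀ x ∈ A, ∀ y ∈ B, x + y ∈ C) :
    volume A + volume B ≤ volume C := by
  have hα := hA.isGreatest_sSup hA'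
  have hβ := hB.isLeast_sInf hB'
  set α := sSup A
  set β := sInf B
  have hS : MeasurableSet ((fun x => x + -α) ⁻¹' B) :=
    (measurable_add_const _) hB.measurableSet
  rw [← measure_preimage_add_right volume (-β) A, ← measure_preimage_add_right volume (-α) B,
    ← measure_union₀ hS.nullMeasurableSet]
  · refine measure_mono ?_
    rintro x (hx | hx)
    · simpa using h _ hx _ hβ.1
    · simpa using h _ hα.1 _ hx
  · refine measure_mono_null (t := {α + β}) ?_ (by simp)
    rintro x ⟨hx, hx'⟩
    have h1 := hα.2 hx
    have h2 := hβ.2 hx'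
    simp only [Set.mem_singleton_iff]
    linarith

/-- One-dimensional Brunn–Minkowski inequality for measurable sets. -/
theorem volume_add_volume_le {A B C : Set ℝ} (hA : MeasurableSet A) (hB : MeasurableSet B)
    (hA' : A.Nonempty) (hB' : B.Nonempty) (h : ∀ x ∈ A, ∀ y ∈ B, x + y ∈ C) :
    volume A + volume B ≤ volume C := by
  obtain ⟨a, ha⟩ := hA'
  obtain ⟨b, hb⟩ := hB'
  have hsup {S : Set ℝ} (hS : MeasurableSet S) :
      volume S = ⨆ (K) (_ : K ⊆ S ∧ IsCompact K), volume K := by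
    simp only [iSup_and]
    exact hS.measure_eq_iSup_isCompact volume
  rw [hsup hA, hsup hB]
  refine ENNReal.biSup_add_biSup_le' ⟨∅, by simp⟩ ⟨∅, by simp⟩ ?_
  rintro K ⟨hKA, hK⟩ L ⟨hLB, hL⟩
  calc volume K + volume L ≤ volume (insert a K) + volume (insert b L) := by
        gcongr <;> exact Set.subset_insert _ _
    _ ≤ volume C := by
        refine volume_add_volume_le_of_isCompact (hK.insert a) (hL.insert b)
          (Set.insert_nonempty _ _) (Set.insert_nonempty _ _) fun x hx y hy => h x ?_ y ?_
        · exact Set.insert_subset ha hKA hx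
        · exact Set.insert_subset hb hLB hy

/-- A Prékopa–Leindler type inequality for functions with supremum `1`. -/
theorem lintegral_add_lintegral_le_of_levels {f g k : ℝ → ℝ} (hf : Measurable f)
    (hg : Measurable g) (hk : Measurable k) (hf0 : ∀ x, 0 ≤ f x) (hg0 : ∀ x, 0 ≤ g x)
    (hk0 : ∀ x, 0 ≤ k x) (hf1 : ∀ x, f x ≤ 1) (hg1 : ∀ x, g x ≤ 1)
    (hfs : ∀ s < 1, ∃ x, s < f x) (hgs : ∀ s < 1, ∃ x, s < g x)
    (h : ∀ s, 0 < s → ∀ x y, s < f x → s < g y → s < k (x + y)) :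
    (∫⁻ x, ENNReal.ofReal (f x)) + ∫⁻ x, ENNReal.ofReal (g x) ≤ ∫⁻ x, ENNReal.ofReal (k x) := by
  rw [lintegral_eq_lintegral_meas_lt volume (.of_forall hf0) hf.aemeasurable,
    lintegral_eq_lintegral_meas_lt volume (.of_forall hg0) hg.aemeasurable,
    lintegral_eq_lintegral_meas_lt volume (.of_forall hk0) hk.aemeasurable,
    ← lintegral_add_left]
  · refine setLIntegral_mono' measurableSet_Ioi fun s hs => ?_
    rcases lt_or_ge s 1 with hs1 | hs1
    · exact volume_add_volume_le (measurableSet_lt measurable_const hf)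
        (measurableSet_lt measurable_const hg) (hfs s hs1) (hgs s hs1)
        fun x hx y hy => h s hs x y hx hy
    · have hfe : {a | s < f a} = ∅ := by
        ext x; simpa using (hf1 x).trans hs1
      have hge : {a | s < g a} = ∅ := by
        ext x; simpa using (hg1 x).trans hs1
      simp [hfe, hge]
  · have : Antitone fun s : ℝ => volume {a | s < f a} :=
      fun s t hst => measure_mono fun x hx => lt_of_le_of_lt hst hx
    exact this.measurable

/-- Boundedness of a summand in a sup-convolution with integrable majorant. -/
theorem iSup_ne_top_of_add_le {f g h : ℝ → ENNReal} (hg : Measurable g)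
    (hfgh : ∀ x y, f x ≠ 0 → g y ≠ 0 → f x + g y ≤ h (x + y))
    (hgi : ∫⁻ x, g x ≠ 0) (hhi : ∫⁻ x, h x ≠ ⊤) : ⨆ x, f x ≠ ⊤ := by
  set S := {y | g y ≠ 0}
  have hSm : MeasurableSet S := hg (measurableSet_singleton 0).compl
  have hS : volume S ≠ 0 := by
    contrapose! hgi
    rw [lintegral_eq_zero_iff hg]
    exact hgi
  have hb : ∀ x, f x ≤ (∫⁻ x, h x) / volume S := by
    intro x
    by_cases hx : f x = 0
    · simp [hx]
    rw [ENNReal.le_div_iff_mul_le (.inl hS) (.inr hhi), ← setLIntegral_const,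
      ← lintegral_add_left_eq_self h x]
    exact (setLIntegral_mono' hSm fun y hy => le_self_add.trans (hfgh x y hx hy)).trans
      (setLIntegral_le_lintegral _ _)
  exact ne_top_of_le_ne_top (ENNReal.div_ne_top hhi hS) (iSup_le hb)

theorem iSup_ne_zero_of_lintegral_ne_zero {f : ℝ → ENNReal} (hf : ∫⁻ x, f x ≠ 0) :
    ⨆ x, f x ≠ 0 := by
  contrapose! hf
  simp [ENNReal.iSup_eq_zero.1 hf]

theorem exists_lt_toReal_div_iSup {f : ℝ → ENNReal} (h0 : ⨆ x, f x ≠ 0) (ht : ⨆ x, f x ≠ ⊤)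
    {s : ℝ} (hs : s < 1) : ∃ x, s < (f x / ⨆ x, f x).toReal := by
  rcases lt_or_ge s 0 with hs0 | hs0
  · exact ⟨0, hs0.trans_le ENNReal.toReal_nonneg⟩
  have : ENNReal.ofReal s * (⨆ x, f x) < ⨆ x, f x := by
    nth_rewrite 2 [← one_mul (⨆ x, f x)]
    rw [ENNReal.mul_lt_mul_iff_left h0 ht]
    simpa using hs
  obtain ⟨x, hx⟩ := lt_iSup_iff.1 this
  refine ⟨x, ?_⟩
  have hx' : f x ≠ ⊤ := ne_top_of_le_ne_top ht (le_iSup f x)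
  rwa [← ENNReal.ofReal_lt_iff_lt_toReal hs0 (ENNReal.div_ne_top hx' h0),
    ENNReal.lt_div_iff_mul_lt (.inl h0) (.inl ht)]

theorem lintegral_ofReal_toReal_div {f : ℝ → ENNReal} (hf : Measurable f) {a : ENNReal}
    (ha0 : a ≠ 0) (hfa : ∀ x, f x ≠ ⊤) :
    ∫⁻ x, ENNReal.ofReal (f x / a).toReal = (∫⁻ x, f x) / a := by
  simp_rw [fun x => ENNReal.ofReal_toReal (ENNReal.div_ne_top (hfa x) ha0), div_eq_mul_inv]
  exact lintegral_mul_const _ hf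

theorem toReal_div_le_one {a b : ENNReal} (h : a ≤ b) : (a / b).toReal ≤ 1 := by
  rw [← ENNReal.toReal_one]
  exact ENNReal.toReal_mono ENNReal.one_ne_top (ENNReal.div_le_of_le_mul (by rwa [one_mul]))

/-- Integral form of Bonnesen's refinement of the Brunn–Minkowski inequality, with the maximal
section lengths replaced by suprema. -/
theorem lintegral_div_add_lintegral_div_le {f g h : ℝ → ENNReal} (hf : Measurable f)
    (hg : Measurable g) (hh : Measurable h)
    (hfgh : ∀ x y, f x ≠ 0 → g y ≠ 0 → f x + g y ≤ h (x + y))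
    (ha0 : ⨆ x, f x ≠ 0) (hat : ⨆ x, f x ≠ ⊤) (hb0 : ⨆ x, g x ≠ 0) (hbt : ⨆ x, g x ≠ ⊤) :
    (∫⁻ x, f x) / (⨆ x, f x) + (∫⁻ x, g x) / (⨆ x, g x) ≤
      (∫⁻ x, h x) / ((⨆ x, f x) + ⨆ x, g x) := by
  have hfa := le_iSup f
  have hgb := le_iSup g
  have hfl := fun s => exists_lt_toReal_div_iSup (s := s) ha0 hat
  have hgl := fun s => exists_lt_toReal_div_iSup (s := s) hb0 hbt
  set a := ⨆ x, f x
  set b := ⨆ x, g x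
  have hab0 : a + b ≠ 0 := by simp [ha0]
  have habt : a + b ≠ ⊤ := by simp [hat, hbt]
  have hft : ∀ x, f x ≠ ⊤ := fun x => ne_top_of_le_ne_top hat (hfa x)
  have hgt : ∀ x, g x ≠ ⊤ := fun x => ne_top_of_le_ne_top hbt (hgb x)
  have hmt : ∀ x, min (h x) (a + b) ≠ ⊤ := fun x => ne_top_of_le_ne_top habt (min_le_right _ _)
  have hmin : Measurable fun x => min (h x) (a + b) := hh.min measurable_const
  calc _ = (∫⁻ x, ENNReal.ofReal (f x / a).toReal) + ∫⁻ x, ENNReal.ofReal (g x / b).toReal := by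
        rw [lintegral_ofReal_toReal_div hf ha0 hft, lintegral_ofReal_toReal_div hg hb0 hgt]
    _ ≤ ∫⁻ x, ENNReal.ofReal (min (h x) (a + b) / (a + b)).toReal := by
        refine lintegral_add_lintegral_le_of_levels (hf.div_const a).ennreal_toReal
          (hg.div_const b).ennreal_toReal (hmin.div_const _).ennreal_toReal
          (fun _ => ENNReal.toReal_nonneg) (fun _ => ENNReal.toReal_nonneg)
          (fun _ => ENNReal.toReal_nonneg) (fun x => toReal_div_le_one (hfa x))
          (fun x => toReal_div_le_one (hgb x)) hfl hgl fun s hs x y hx hy => ?_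
        rw [← ENNReal.ofReal_lt_iff_lt_toReal hs.le (ENNReal.div_ne_top (hft x) ha0),
          ENNReal.lt_div_iff_mul_lt (.inl ha0) (.inl hat)] at hx
        rw [← ENNReal.ofReal_lt_iff_lt_toReal hs.le (ENNReal.div_ne_top (hgt y) hb0),
          ENNReal.lt_div_iff_mul_lt (.inl hb0) (.inl hbt)] at hy
        rw [← ENNReal.ofReal_lt_iff_lt_toReal hs.le (ENNReal.div_ne_top (hmt _) hab0),
          ENNReal.lt_div_iff_mul_lt (.inl hab0) (.inl habt), mul_add]
        exact (ENNReal.add_lt_add hx hy).trans_le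
          (le_min (hfgh x y (ne_bot_of_gt hx) (ne_bot_of_gt hy)) (add_le_add (hfa x) (hgb y)))
    _ = (∫⁻ x, min (h x) (a + b)) / (a + b) := lintegral_ofReal_toReal_div hmin hab0 hmt
    _ ≤ _ := by
        gcongr
        exact min_le_left _ _

theorem add_add_two_mul_sqrt_le {a b F G H : ℝ} (ha : 0 < a) (hb : 0 < b) (hF : 0 ≤ F)
    (hG : 0 ≤ G) (h : F / a + G / b ≤ H / (a + b)) : F + G + 2 * √(F * G) ≤ H := by
  rw [le_div_iff₀ (by positivity)] at h
  refine le_trans ?_ h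
  rw [Real.sqrt_mul hF]
  obtain ⟨p, hp, rfl⟩ : ∃ p, 0 ≤ p ∧ F = p ^ 2 := ⟨√F, by positivity, (Real.sq_sqrt hF).symm⟩
  obtain ⟨q, hq, rfl⟩ : ∃ q, 0 ≤ q ∧ G = q ^ 2 := ⟨√G, by positivity, (Real.sq_sqrt hG).symm⟩
  rw [Real.sqrt_sq hp, Real.sqrt_sq hq, ← sub_nonneg]
  have : (p ^ 2 / a + q ^ 2 / b) * (a + b) - (p ^ 2 + q ^ 2 + 2 * (p * q)) =
      (b * p - a * q) ^ 2 / (a * b) := by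
    field_simp
    ring
  rw [this]
  positivity

/-- The Brunn–Minkowski inequality in `ℝ × ℝ`. -/
theorem brunn_minkowski_prod {A B C : Set (ℝ × ℝ)} (hA : MeasurableSet A) (hB : MeasurableSet B)
    (hC : MeasurableSet C) (h : ∀ p ∈ A, ∀ q ∈ B, p + q ∈ C)
    (hA0 : volume A ≠ 0) (hB0 : volume B ≠ 0) (hCt : volume C ≠ ⊤) :
    (volume A).toReal + (volume B).toReal + 2 * √((volume A).toReal * (volume B).toReal) ≤
      (volume C).toReal := by
  have hfgh : ∀ x y, volume (Prod.mk x ⁻¹' A) ≠ 0 → volume (Prod.mk y ⁻¹' B) ≠ 0 →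
      volume (Prod.mk x ⁻¹' A) + volume (Prod.mk y ⁻¹' B) ≤ volume (Prod.mk (x + y) ⁻¹' C) :=
    fun x y hx hy => volume_add_volume_le (measurable_prodMk_left hA) (measurable_prodMk_left hB)
      (nonempty_of_measure_ne_zero hx) (nonempty_of_measure_ne_zero hy)
      fun u hu v hv => h (x, u) hu (y, v) hv
  rw [Measure.volume_eq_prod] at hA0 hB0 hCt ⊢
  rw [Measure.prod_apply hA] at hA0 ⊢
  rw [Measure.prod_apply hB] at hB0 ⊢
  rw [Measure.prod_apply hC] at hCt ⊢
  have hf := measurable_measure_prodMk_left (ν := (volume : Measure ℝ)) hA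
  have hg := measurable_measure_prodMk_left (ν := (volume : Measure ℝ)) hB
  have hh := measurable_measure_prodMk_left (ν := (volume : Measure ℝ)) hC
  have ha0 := iSup_ne_zero_of_lintegral_ne_zero hA0
  have hb0 := iSup_ne_zero_of_lintegral_ne_zero hB0
  have hat := iSup_ne_top_of_add_le hg hfgh hB0 hCt
  have hbt := iSup_ne_top_of_add_le (h := fun x => volume (Prod.mk x ⁻¹' C)) hf
    (fun y x hy hx => by rw [add_comm, add_comm y x]; exact hfgh x y hx hy) hA0 hCt
  have key := lintegral_div_add_lintegral_div_le hf hg hh hfgh ha0 hat hb0 hbt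
  have hdiv := ENNReal.div_ne_top hCt (add_ne_zero.2 (.inl ha0) :
    (⨆ x, volume (Prod.mk x ⁻¹' A)) + ⨆ x, volume (Prod.mk x ⁻¹' B) ≠ 0)
  have hsum := ne_top_of_le_ne_top hdiv key
  rw [ENNReal.add_ne_top] at hsum
  have key' := ENNReal.toReal_mono hdiv key
  rw [ENNReal.toReal_add hsum.1 hsum.2, ENNReal.toReal_div, ENNReal.toReal_div,
    ENNReal.toReal_div, ENNReal.toReal_add hat hbt] at key'
  exact add_add_two_mul_sqrt_le (ENNReal.toReal_pos ha0 hat) (ENNReal.toReal_pos hb0 hbt)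
    ENNReal.toReal_nonneg ENNReal.toReal_nonneg key'

/-- The Brunn–Minkowski inequality in the Euclidean plane. -/
theorem brunn_minkowski_plane {A B C : Set (EuclideanSpace ℝ (Fin 2))} (hA : MeasurableSet A)
    (hB : MeasurableSet B) (hC : MeasurableSet C) (h : ∀ p ∈ A, ∀ q ∈ B, p + q ∈ C)
    (hA0 : volume A ≠ 0) (hB0 : volume B ≠ 0) (hCt : volume C ≠ ⊤) :
    (volume A).toReal + (volume B).toReal + 2 * √((volume A).toReal * (volume B).toReal) ≤
      (volume C).toReal := by
  let e : EuclideanSpace ℝ (Fin 2) ≃ᵐ ℝ × ℝ :=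
    (MeasurableEquiv.toLp 2 (Fin 2 → ℝ)).symm.trans MeasurableEquiv.finTwoArrow
  have he : MeasurePreserving e.symm volume volume :=
    ((EuclideanSpace.volume_preserving_symm_measurableEquiv_toLp (Fin 2)).trans
      (volume_preserving_finTwoArrow ℝ)).symm e
  have hadd : ∀ p q, e.symm (p + q) = e.symm p + e.symm q := by
    intro p q
    apply e.injective
    rw [e.apply_symm_apply]
    conv_lhs => rw [← e.apply_symm_apply p, ← e.apply_symm_apply q]
    rfl
  have hvol : ∀ S, volume (e.symm ⁻¹' S) = volume S := fun S => he.measure_preimage_equiv S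
  have key := brunn_minkowski_prod (e.symm.measurable hA) (e.symm.measurable hB)
    (e.symm.measurable hC) (fun p hp q hq => by
      rw [Set.mem_preimage, hadd]
      exact h _ hp _ hq)
  simp only [hvol] at key
  exact key hA0 hB0 hCt

/-- Isoperimetric blow-up bound: for a measurable set Y in the plane of finite
area and r > 0, the set of points within distance r of Y but not in Y has area
at least πr² + 2r√(π|Y|). -/
theorem blowup_area_lower_bound (Y : Set (EuclideanSpace ℝ (Fin 2)))
    (hY : MeasurableSet Y) (hYfin : volume Y < ⊤) (r : ℝ) (hr : 0 < r) :
    ENNReal.ofReal (π * r ^ 2 + 2 * r * Real.sqrt (π * (volume Y).toReal)) ≤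
      volume {p | p ∉ Y ∧ Metric.infDist p Y ≤ r} := by
  rcases Y.eq_empty_or_nonempty with rfl | ⟨y, hy⟩
  · simp [hr.le]
  set C := {p | Metric.infDist p Y ≤ r}
  have hC : MeasurableSet C :=
    (isClosed_le (continuous_infDist_pt Y) continuous_const).measurableSet
  have hYC : Y ⊆ C := fun p hp => by simp [C, infDist_zero_of_mem hp, hr.le]
  have hZ : {p | p ∉ Y ∧ Metric.infDist p Y ≤ r} = C \ Y := by
    ext p
    exact and_comm
  have hadd : ∀ p ∈ Y, ∀ q ∈ closedBall (0 : EuclideanSpace ℝ (Fin 2)) r, p + q ∈ C := by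
    intro p hp q hq
    refine (infDist_le_dist_of_mem hp).trans ?_
    simpa using hq
  have hball (x : EuclideanSpace ℝ (Fin 2)) :
      volume (closedBall x r) = ENNReal.ofReal (π * r ^ 2) := by
    rw [EuclideanSpace.volume_closedBall_fin_two, mul_comm, ENNReal.ofReal_mul pi_pos.le,
      ENNReal.ofReal_pow hr.le]
  have hpos : 0 < π * r ^ 2 := by positivity
  rw [hZ, measure_sdiff hYC hY.nullMeasurableSet hYfin.ne]
  by_cases hCt : volume C = ⊤
  · simp [hCt, ENNReal.top_sub hYfin.ne]
  by_cases hY0 : volume Y = 0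
  · rw [hY0]
    simp only [ENNReal.toReal_zero, mul_zero, Real.sqrt_zero, add_zero, tsub_zero, ← hball y]
    exact measure_mono fun p hp => (infDist_le_dist_of_mem hy).trans hp
  have key := brunn_minkowski_plane hY measurableSet_closedBall hC hadd hY0
    (by simpa [hball] using hpos) hCt
  rw [hball, ENNReal.toReal_ofReal hpos.le,
    show (volume Y).toReal * (π * r ^ 2) = r ^ 2 * (π * (volume Y).toReal) by ring,
    Real.sqrt_mul (by positivity), Real.sqrt_sq hr.le] at key
  rw [← ENNReal.ofReal_toReal hCt, ← ENNReal.ofReal_toReal hYfin.ne,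
    ← ENNReal.ofReal_sub _ ENNReal.toReal_nonneg, ENNReal.toReal_ofReal ENNReal.toReal_nonneg]
  exact ENNReal.ofReal_le_ofReal (by linarith)
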